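/- arXiv:2410.06365 — 5 statements merged into one kernel-verified Lean document; each statement's English description precedes it below -/
import Mathlib

section
/- Let N ≥ 2 and θ₁, ..., θ_N be real numbers with Σ_{1 ≤ i < j ≤ N} sin²(θ_i − θ_j) ≠ 0. Define the 2×2 matrix F̃_AO = N · Σ_{i=1}^N M_i, where M_i has entries (M_i)₁₁ = sin² θ_i, (M_i)₁₂ = (M_i)₂₁ = −sin θ_i cos θ_i, (M_i)₂₂ = cos² θ_i. Then F̃_AO is invertible and tr(F̃_AO⁻¹) = 1 / Σ_{1 ≤ i < j ≤ N} sin²(θ_i − θ_j). -/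
open Finset Real Matrix

/-- A double sum whose diagonal vanishes, folded onto the pairs `i < j`. -/
theorem sum_sum_eq_sum_sum_lt_add_swap {ι M : Type*} [Fintype ι] [LinearOrder ι]
    [AddCommMonoid M] (g : ι → ι → M) (hg : ∀ i, g i i = 0) :
    ∑ i, ∑ j, g i j = ∑ i, ∑ j ∈ univ.filter (fun j => i < j), (g i j + g j i) := by
  simp_rw [sum_add_distrib, sum_filter]
  rw [sum_comm (f := fun i j => if i < j then g j i else 0)]
  simp_rw [← sum_add_distrib]
  refine sum_congr rfl fun i _ => sum_congr rfl fun j _ => ?_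
  rcases lt_trichotomy i j with hij | rfl | hij
  · simp [hij, hij.not_gt]
  · simp [hg]
  · simp [hij, hij.not_gt]

/-- Lagrange's identity. -/
theorem sum_sq_mul_sum_sq_sub_sq_sum_mul {ι R : Type*} [Fintype ι] [LinearOrder ι]
    [CommRing R] (a b : ι → R) :
    (∑ i, a i ^ 2) * (∑ i, b i ^ 2) - (∑ i, a i * b i) ^ 2 =
      ∑ i, ∑ j ∈ univ.filter (fun j => i < j), (a i * b j - b i * a j) ^ 2 := by
  rw [sq (∑ i, a i * b i), sum_mul_sum, sum_mul_sum]
  simp_rw [← sum_sub_distrib]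
  rw [sum_sum_eq_sum_sum_lt_add_swap _ fun i => by ring]
  exact sum_congr rfl fun i _ => sum_congr rfl fun j _ => by ring

/-- Proposition 2 (exact algebraic identity): the orientation-controlled AOA GDoP matrix
`F̃_AO = N • Σᵢ Mᵢ`, with `Mᵢ = !![sin² θᵢ, −sin θᵢ cos θᵢ; −sin θᵢ cos θᵢ, cos² θᵢ]`,
is invertible and `tr(F̃_AO⁻¹) = 1 / Σ_{i<j} sin²(θᵢ − θⱼ)`. -/
theorem trace_inv_orientation_gdop {N : ℕ} (hN : 2 ≤ N) (θ : Fin N → ℝ)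
    (h : ∑ i : Fin N, ∑ j ∈ Finset.univ.filter (fun j => i < j),
        (sin (θ i - θ j)) ^ 2 ≠ 0) :
    IsUnit ((N : ℝ) • ∑ i : Fin N,
        !![(sin (θ i)) ^ 2, (-(sin (θ i) * cos (θ i)));
           (-(sin (θ i) * cos (θ i))), (cos (θ i)) ^ 2]) ∧
      ((N : ℝ) • ∑ i : Fin N,
        !![(sin (θ i)) ^ 2, (-(sin (θ i) * cos (θ i)));
           (-(sin (θ i) * cos (θ i))), (cos (θ i)) ^ 2])⁻¹.trace =
        1 / ∑ i : Fin N, ∑ j ∈ Finset.univ.filter (fun j => i < j),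
            (sin (θ i - θ j)) ^ 2 := by
  set S := ∑ i : Fin N, ∑ j ∈ Finset.univ.filter (fun j => i < j), (sin (θ i - θ j)) ^ 2 with hS
  set F := (N : ℝ) • ∑ i : Fin N,
    !![(sin (θ i)) ^ 2, (-(sin (θ i) * cos (θ i)));
       (-(sin (θ i) * cos (θ i))), (cos (θ i)) ^ 2] with hF
  have hN0 : (N : ℝ) ≠ 0 := by
    exact_mod_cast (show N ≠ 0 by lia)
  have hdet : F.det = (N : ℝ) ^ 2 * S := by
    simp_rw [hS, sin_sub]
    rw [← sum_sq_mul_sum_sq_sub_sq_sum_mul (fun i => sin (θ i)) (fun i => cos (θ i))]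
    simp only [hF, Matrix.det_fin_two, Matrix.smul_apply, Matrix.sum_apply, smul_eq_mul,
      Matrix.of_apply, Matrix.cons_val', Matrix.cons_val_zero, Matrix.cons_val_one,
      Matrix.cons_val_fin_one, sum_neg_distrib]
    ring
  have htrace : F.trace = (N : ℝ) ^ 2 := by
    simp [hF, Matrix.trace_sum, Matrix.trace_fin_two, sq (N : ℝ)]
  have hdet0 : F.det ≠ 0 := hdet ▸ mul_ne_zero (pow_ne_zero 2 hN0) h
  have hadj : F.adjugate.trace = F.trace := by
    simp [Matrix.adjugate_fin_two, Matrix.trace_fin_two, add_comm]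
  refine ⟨(Matrix.isUnit_iff_isUnit_det F).2 hdet0.isUnit, ?_⟩
  rw [Matrix.inv_def, Matrix.trace_smul, hadj, htrace, hdet, Ring.inverse_eq_inv', smul_eq_mul]
  field_simp
end

section
/- Fix real constants ζ > 0 and λ > 0, and for N ≥ 2 define C(N) = (32·ζ⁻²·Σ_{i=1}^N i⁻²) / (3·λ³·π³·(Σ_{k=1}^N k⁻¹)·((Σ_{i=1}^N i⁻²)² − Σ_{i=1}^N i⁻⁴)). Then lim_{N→∞} C(N)·ln N = 320/(3·ζ²·λ³·π⁵). -/
open Filter Finset Real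

/-- The partial sums over `1, …, N` of the reciprocals of the `p`-th powers converge to the sum of
the corresponding series (the index `0` contributes nothing when `p ≠ 0`). -/
theorem tendsto_sum_Icc_inv_pow {p : ℕ} (hp : p ≠ 0) {s : ℝ}
    (hs : HasSum (fun n : ℕ => (1 : ℝ) / (n : ℝ) ^ p) s) :
    Tendsto (fun N : ℕ => ∑ i ∈ Finset.Icc 1 N, ((i : ℝ) ^ p)⁻¹) atTop (nhds s) := by
  refine (hs.tendsto_sum_nat.comp (tendsto_add_atTop_nat 1)).congr fun N => ?_
  rw [Function.comp_apply, Finset.range_eq_Ico, Finset.sum_eq_sum_Ico_succ_bot N.succ_pos]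
  simp [hp, Finset.Ico_add_one_right_eq_Icc]

/-- The harmonic numbers are asymptotic to the logarithm. -/
theorem tendsto_log_div_sum_Icc_inv :
    Tendsto (fun N : ℕ => Real.log N / ∑ k ∈ Finset.Icc 1 N, (k : ℝ)⁻¹) atTop (nhds 1) := by
  have hlog : Tendsto (fun N : ℕ => Real.log N) atTop atTop :=
    Real.tendsto_log_atTop.comp tendsto_natCast_atTop_atTop
  have h := ((Real.tendsto_harmonic_sub_log.div_atTop hlog).const_add 1).inv₀ (by norm_num)
  rw [add_zero, inv_one] at h
  refine h.congr' ?_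
  filter_upwards [hlog.eventually_gt_atTop 0] with N hN
  have hharm : (harmonic N : ℝ) = ∑ k ∈ Finset.Icc 1 N, (k : ℝ)⁻¹ := by
    simp [harmonic_eq_sum_Icc]
  rw [← hharm, sub_div, div_self hN.ne', add_sub_cancel, inv_div]

/-- Theorem 1 (AOA scaling law): with `C(N)` the approximated expected CRLB of AOA-based
cooperative localization (equation (27) with path-loss exponent β = 2), the product
`C(N) · ln N` converges to `320 / (3 ζ² λ³ π⁵)` as `N → ∞`. -/
theorem aoa_crlb_scaling_law (ζ lam : ℝ) (hζ : 0 < ζ) (hlam : 0 < lam) :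
    Tendsto (fun N : ℕ =>
        (32 * ζ⁻¹ ^ 2 * ∑ i ∈ Finset.Icc 1 N, ((i : ℝ) ^ 2)⁻¹) /
          (3 * lam ^ 3 * π ^ 3 * (∑ k ∈ Finset.Icc 1 N, (k : ℝ)⁻¹) *
            ((∑ i ∈ Finset.Icc 1 N, ((i : ℝ) ^ 2)⁻¹) ^ 2
              - ∑ i ∈ Finset.Icc 1 N, ((i : ℝ) ^ 4)⁻¹)) *
        Real.log N)
      atTop (nhds (320 / (3 * ζ ^ 2 * lam ^ 3 * π ^ 5))) := by
  have h2 := tendsto_sum_Icc_inv_pow two_ne_zero hasSum_zeta_two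
  have h4 := tendsto_sum_Icc_inv_pow four_ne_zero hasSum_zeta_four
  have hden : 3 * lam ^ 3 * π ^ 3 * ((π ^ 2 / 6) ^ 2 - π ^ 4 / 90) ≠ 0 := by
    have : (π ^ 2 / 6) ^ 2 - π ^ 4 / 90 = π ^ 4 / 60 := by ring
    rw [this]
    positivity
  have h := ((h2.const_mul (32 * ζ⁻¹ ^ 2)).div
    (((h2.pow 2).sub h4).const_mul (3 * lam ^ 3 * π ^ 3)) hden).mul tendsto_log_div_sum_Icc_inv
  convert h using 2 with N
  · rw [Pi.div_apply, div_mul_div_comm, div_mul_eq_mul_div]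
    congr 1
    ring
  · have : (π ^ 2 / 6) ^ 2 - π ^ 4 / 90 = π ^ 4 / 60 := by ring
    rw [this]
    field_simp
    norm_num
end

section
/- Fix real constants ζ_R > 0, ζ_A > 0, λ > 0, and Euler's constant γ. For N ≥ 2 set H = ln N + γ + 1/(2N) and define R(N) = (2·ζ_R·H + (π³λ/12)·ζ_A) / (ζ_R²·π²·λ²·H³ + (π⁸λ⁴/1280)·ζ_A²·H + (π⁵λ³/12)·ζ_R·ζ_A·H²). Then lim_{N→∞} R(N)·(12·ζ_R·λ²·π²·(ln N)² + λ³·π⁵·ζ_A·ln N) = 24. -/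
open Filter Real

/-- If `L → ∞` and `s` converges, then with `H = L + s` the rational expression below in `H` and `L`
tends to the quotient of its leading coefficients. -/
theorem tendsto_ratio_mul_of_tendsto_atTop {α : Type*} {l : Filter α} {L s : α → ℝ} {t : ℝ}
    (hL : Tendsto L l atTop) (hs : Tendsto s l (nhds t)) (a b c d e p q : ℝ) (hc : c ≠ 0) :
    Tendsto (fun x => (a * (L x + s x) + b) /
        (c * (L x + s x) ^ 3 + d * (L x + s x) + e * (L x + s x) ^ 2) *
        (p * L x ^ 2 + q * L x)) l (nhds (a * p / c)) := by
  have hH : Tendsto (fun x => L x + s x) l atTop := hL.atTop_add hs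
  have hu : Tendsto (fun x => (L x + s x)⁻¹) l (nhds 0) := hH.inv_tendsto_atTop
  have hr : Tendsto (fun x => 1 - s x * (L x + s x)⁻¹) l (nhds 1) := by
    simpa using (hs.mul hu).const_sub 1
  have hnum := ((hu.const_mul b).const_add a).mul
    (((hr.pow 2).const_mul p).add ((hr.const_mul q).mul hu))
  have hden := (((hu.pow 2).const_mul d).const_add c).add (hu.const_mul e)
  have hlim := hnum.div hden (by simpa using hc)
  have hval : (a + b * 0) * (p * 1 ^ 2 + q * 1 * 0) / (c + d * 0 ^ 2 + e * 0) = a * p / c := by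
    simp
  rw [hval] at hlim
  refine hlim.congr' ?_
  filter_upwards [hH.eventually_gt_atTop 0] with x hx
  obtain ⟨h, hh⟩ : ∃ h, h = L x + s x := ⟨_, rfl⟩
  have hLx : L x = h - s x := by linarith
  have h0 : h ≠ 0 := by rw [hh]; exact hx.ne'
  have hden_eq : c * h ^ 3 + d * h + e * h ^ 2 = h ^ 3 * (c + d * h⁻¹ ^ 2 + e * h⁻¹) := by
    field_simp
  have hnum_eq : (a * h + b) * (p * (h - s x) ^ 2 + q * (h - s x)) =
      h ^ 3 * ((a + b * h⁻¹) *
        (p * (1 - s x * h⁻¹) ^ 2 + q * (1 - s x * h⁻¹) * h⁻¹)) := by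
    field_simp
  simp only [Pi.div_apply]
  rw [← hh, hLx, div_mul_eq_mul_div, hden_eq, hnum_eq, mul_div_mul_left _ _ (pow_ne_zero 3 h0)]

/-- Proposition 9 (hybrid localization scaling law): with
`H = ln N + γ + 1/(2N)` (γ Euler's constant) and `R(N)` the approximated expected CRLB of the
hybrid AOA-plus-TOF localization (equation (55)),
`lim_{N→∞} R(N) · (12 ζ_R λ² π² ln² N + λ³ π⁵ ζ_A ln N) = 24`. -/
theorem hybrid_crlb_scaling_law (ζR ζA lam : ℝ) (hζR : 0 < ζR) (hζA : 0 < ζA)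
    (hlam : 0 < lam) :
    Tendsto (fun N : ℕ =>
        ((2 * ζR * (Real.log N + eulerMascheroniConstant + 1 / (2 * (N : ℝ)))
            + (π ^ 3 * lam / 12) * ζA) /
          (ζR ^ 2 * π ^ 2 * lam ^ 2 *
              (Real.log N + eulerMascheroniConstant + 1 / (2 * (N : ℝ))) ^ 3
            + (π ^ 8 * lam ^ 4 / 1280) * ζA ^ 2 *
              (Real.log N + eulerMascheroniConstant + 1 / (2 * (N : ℝ)))
            + (π ^ 5 * lam ^ 3 / 12) * ζR * ζA *
              (Real.log N + eulerMascheroniConstant + 1 / (2 * (N : ℝ))) ^ 2)) *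
        (12 * ζR * lam ^ 2 * π ^ 2 * (Real.log N) ^ 2
          + lam ^ 3 * π ^ 5 * ζA * Real.log N))
      atTop (nhds 24) := by
  have hL : Tendsto (fun N : ℕ => Real.log N) atTop atTop :=
    tendsto_log_atTop.comp tendsto_natCast_atTop_atTop
  have hs : Tendsto (fun N : ℕ => eulerMascheroniConstant + 1 / (2 * (N : ℝ))) atTop
      (nhds (eulerMascheroniConstant + 0)) :=
    ((tendsto_natCast_atTop_atTop.const_mul_atTop two_pos).const_div_atTop 1).const_add _
  have hmain := tendsto_ratio_mul_of_tendsto_atTop hL hs (2 * ζR) (π ^ 3 * lam / 12 * ζA)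
    (ζR ^ 2 * π ^ 2 * lam ^ 2) (π ^ 8 * lam ^ 4 / 1280 * ζA ^ 2)
    (π ^ 5 * lam ^ 3 / 12 * ζR * ζA) (12 * ζR * lam ^ 2 * π ^ 2) (lam ^ 3 * π ^ 5 * ζA)
    (by positivity)
  have hval : 2 * ζR * (12 * ζR * lam ^ 2 * π ^ 2) / (ζR ^ 2 * π ^ 2 * lam ^ 2) = 24 := by
    field_simp
    norm_num
  simpa only [hval, ← add_assoc] using hmain
end

section
/- Let α > 2, z > 0 and D > 0 be real numbers. Then ∫_D^∞ (1 − 1/(1 + z·x^{−α})) · x dx = (z^{2/α}/α) · ∫_0^{z/(z+D^α)} t^{−2/α} · (1 − t)^{2/α − 1} dt, and both integrals are finite. -/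
open MeasureTheory Real

/-- The integrand `(1 - 1 / (1 + z x^{-α})) x` is integrable at infinity, being at most
`z x^{1-α}`. -/
lemma integrableOn_Ioi_one_sub_inv_mul {α z D : ℝ} (hα : 2 < α) (hz : 0 < z) (hD : 0 < D) :
    IntegrableOn (fun x : ℝ => (1 - 1 / (1 + z * x ^ (-α))) * x) (Set.Ioi D) := by
  have hdom : IntegrableOn (fun x : ℝ => z * x ^ (1 - α)) (Set.Ioi D) :=
    (integrableOn_Ioi_rpow_of_lt (by linarith) hD).const_mul z
  refine Integrable.mono' hdom (by fun_prop) ?_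
  filter_upwards [ae_restrict_mem measurableSet_Ioi] with x hx
  have hx0 : 0 < x := hD.trans hx
  have hy : 0 < z * x ^ (-α) := mul_pos hz (rpow_pos_of_pos hx0 _)
  have hsub : 1 - 1 / (1 + z * x ^ (-α)) = z * x ^ (-α) / (1 + z * x ^ (-α)) := by
    field_simp
    ring
  rw [hsub, norm_of_nonneg (by positivity), sub_eq_add_neg, rpow_add hx0, rpow_one,
    mul_comm x, ← mul_assoc]
  gcongr
  exact div_le_self hy.le (by linarith)

lemma hasDerivAt_div_add_rpow {α z x : ℝ} (hz : 0 < z) (hx : 0 < x) :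
    HasDerivAt (fun x : ℝ => z / (z + x ^ α)) (-(z * (α * x ^ (α - 1)) / (z + x ^ α) ^ 2)) x := by
  have hs : z + x ^ α ≠ 0 := (add_pos hz (rpow_pos_of_pos hx _)).ne'
  have h := ((hasDerivAt_rpow_const (p := α) (Or.inl hx.ne')).const_add z).inv hs |>.const_mul z
  refine h.congr_deriv ?_
  ring

lemma strictAntiOn_div_add_rpow {α z : ℝ} (hα : 0 < α) (hz : 0 < z) :
    StrictAntiOn (fun x : ℝ => z / (z + x ^ α)) (Set.Ici 0) := by
  intro x hx y _ hxy
  have hx' : 0 ≤ x ^ α := rpow_nonneg hx α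
  have : x ^ α < y ^ α := rpow_lt_rpow hx hxy hα
  exact div_lt_div_of_pos_left hz (by linarith) (by linarith)

lemma image_div_add_rpow_Ioi {α z D : ℝ} (hα : 0 < α) (hz : 0 < z) (hD : 0 < D) :
    (fun x : ℝ => z / (z + x ^ α)) '' Set.Ioi D = Set.Ioo 0 (z / (z + D ^ α)) := by
  have hDα : 0 < D ^ α := rpow_pos_of_pos hD α
  ext t
  constructor
  · rintro ⟨x, hx, rfl⟩
    have hx0 : 0 < x := hD.trans hx
    exact ⟨div_pos hz (add_pos hz (rpow_pos_of_pos hx0 α)),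
      strictAntiOn_div_add_rpow hα hz hD.le hx0.le hx⟩
  · rintro ⟨ht0, ht⟩
    have hlt : D ^ α < z / t - z := by
      rw [lt_div_iff₀ (by positivity)] at ht
      rw [lt_sub_iff_add_lt, lt_div_iff₀ ht0]
      linarith
    refine ⟨(z / t - z) ^ α⁻¹, (lt_rpow_inv_iff_of_pos hD.le (by linarith) hα).2 hlt, ?_⟩
    simp only [rpow_inv_rpow (hDα.trans hlt).le hα.ne']
    field_simp
    ring

/-- Pointwise form of the substitution `t = z / (z + x^α)`. -/
lemma deriv_mul_beta_integrand_comp {α z x : ℝ} (hα : 0 < α) (hz : 0 < z) (hx : 0 < x) :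
    z * (α * x ^ (α - 1)) / (z + x ^ α) ^ 2 *
        ((z / (z + x ^ α)) ^ (-2 / α) * (1 - z / (z + x ^ α)) ^ (2 / α - 1)) =
      α / z ^ (2 / α) * ((1 - 1 / (1 + z * x ^ (-α))) * x) := by
  have hxα : 0 < x ^ α := rpow_pos_of_pos hx α
  have hs : 0 < z + x ^ α := add_pos hz hxα
  have h1 : 1 - z / (z + x ^ α) = x ^ α / (z + x ^ α) := by field_simp; ring
  have h2 : 1 - 1 / (1 + z * x ^ (-α)) = z / (z + x ^ α) := by
    rw [rpow_neg hx.le]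
    field_simp
    ring
  have h3 : (x ^ α) ^ (2 / α) = x ^ 2 := by
    rw [← rpow_mul hx.le, mul_div_cancel₀ _ hα.ne', rpow_two]
  rw [h1, h2, neg_div, rpow_neg (by positivity), div_rpow hz.le hs.le, div_rpow hxα.le hs.le,
    rpow_sub_one hxα.ne', rpow_sub_one hs.ne', rpow_sub_one hx.ne', h3]
  have hzp : 0 < z ^ (2 / α) := rpow_pos_of_pos hz _
  have hsp : 0 < (z + x ^ α) ^ (2 / α) := rpow_pos_of_pos hs _
  generalize z ^ (2 / α) = a at *
  generalize (z + x ^ α) ^ (2 / α) = b at *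
  generalize x ^ α = c at *
  field_simp

/-- The core interference integral of Lemma 2 / Appendix E: for path-loss exponent `α > 2`,
`∫_D^∞ (1 − 1/(1 + z x^{−α})) x dx
  = (z^{2/α}/α) ∫_0^{z/(z+D^α)} t^{−2/α} (1−t)^{2/α−1} dt`, and both integrals are finite. -/
theorem interference_integral_eq_beta (α z D : ℝ) (hα : 2 < α) (hz : 0 < z) (hD : 0 < D) :
    IntegrableOn (fun x : ℝ => (1 - 1 / (1 + z * x ^ (-α))) * x) (Set.Ioi D) ∧
    IntegrableOn (fun t : ℝ => t ^ (-2 / α) * (1 - t) ^ (2 / α - 1))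
      (Set.Ioc 0 (z / (z + D ^ α))) ∧
    ∫ x in Set.Ioi D, (1 - 1 / (1 + z * x ^ (-α))) * x
      = (z ^ (2 / α) / α) *
        ∫ t in Set.Ioc (0 : ℝ) (z / (z + D ^ α)), t ^ (-2 / α) * (1 - t) ^ (2 / α - 1) := by
  have hα0 : 0 < α := by linarith
  have hint := integrableOn_Ioi_one_sub_inv_mul hα hz hD
  have hderiv : ∀ x ∈ Set.Ioi D, HasDerivWithinAt (fun x : ℝ => z / (z + x ^ α))
      (-(z * (α * x ^ (α - 1)) / (z + x ^ α) ^ 2)) (Set.Ioi D) x :=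
    fun x hx => (hasDerivAt_div_add_rpow hz (hD.trans hx)).hasDerivWithinAt
  have hanti : AntitoneOn (fun x : ℝ => z / (z + x ^ α)) (Set.Ioi D) :=
    (strictAntiOn_div_add_rpow hα0 hz).antitoneOn.mono fun x hx => (hD.trans hx).le
  have hpt : Set.EqOn (fun x : ℝ => (- -(z * (α * x ^ (α - 1)) / (z + x ^ α) ^ 2)) •
        ((z / (z + x ^ α)) ^ (-2 / α) * (1 - z / (z + x ^ α)) ^ (2 / α - 1)))
      (fun x => α / z ^ (2 / α) * ((1 - 1 / (1 + z * x ^ (-α))) * x)) (Set.Ioi D) := by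
    intro x hx
    simpa only [neg_neg, smul_eq_mul] using deriv_mul_beta_integrand_comp hα0 hz (hD.trans hx)
  refine ⟨hint, ?_, ?_⟩
  · rw [integrableOn_Ioc_iff_integrableOn_Ioo, ← image_div_add_rpow_Ioi hα0 hz hD,
      integrableOn_image_iff_integrableOn_deriv_smul_of_antitoneOn measurableSet_Ioi hderiv hanti,
      integrableOn_congr_fun hpt measurableSet_Ioi]
    exact hint.const_mul _
  · rw [integral_Ioc_eq_integral_Ioo, ← image_div_add_rpow_Ioi hα0 hz hD,
      integral_image_eq_integral_deriv_smul_of_antitoneOn measurableSet_Ioi hderiv hanti,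
      setIntegral_congr_fun measurableSet_Ioi hpt, integral_const_mul, ← mul_assoc]
    have hzp : z ^ (2 / α) ≠ 0 := (rpow_pos_of_pos hz _).ne'
    rw [div_mul_div_cancel₀ hα0.ne', div_self hzp, one_mul]
end

section
/- Let X and Y be independent nonnegative real random variables with Y > 0 almost surely and E[ln(1 + X/Y)] < ∞. Then E[ln(1 + X/Y)] = ∫_0^∞ (1/z)·(1 − E[e^{−zX}])·E[e^{−zY}] dz. -/
open MeasureTheory ProbabilityTheory Real

lemma frullani_exp_kernel_nonneg {x z : ℝ} (y : ℝ) (hx : 0 ≤ x) (hz : 0 < z) :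
    0 ≤ (1 / z) * ((1 - exp (-z * x)) * exp (-z * y)) := by
  have h : exp (-z * x) ≤ 1 := exp_le_one_iff.2 (by nlinarith)
  exact mul_nonneg (by positivity) (mul_nonneg (by linarith) (exp_pos _).le)

lemma frullani_exp_kernel_le {x z : ℝ} (y : ℝ) (hz : 0 < z) :
    (1 / z) * ((1 - exp (-z * x)) * exp (-z * y)) ≤ x * exp (-y * z) := by
  have h : 1 - exp (-z * x) ≤ z * x := by linarith [add_one_le_exp (-z * x)]
  calc (1 / z) * ((1 - exp (-z * x)) * exp (-z * y))
      ≤ (1 / z) * (z * x * exp (-z * y)) := by gcongr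
    _ = x * exp (-y * z) := by
      rw [neg_mul, neg_mul, mul_comm y z]
      field_simp

lemma integrableOn_frullani_exp_kernel {x y : ℝ} (hx : 0 ≤ x) (hy : 0 < y) :
    IntegrableOn (fun z => (1 / z) * ((1 - exp (-z * x)) * exp (-z * y))) (Set.Ioi 0) := by
  have hb : IntegrableOn (fun z => x * exp (-y * z)) (Set.Ioi 0) :=
    (integrableOn_exp_mul_Ioi (neg_neg_of_pos hy) 0).const_mul x
  refine Integrable.mono' hb (by fun_prop) ?_
  filter_upwards [ae_restrict_mem measurableSet_Ioi] with z hz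
  rw [norm_of_nonneg (frullani_exp_kernel_nonneg y hx hz)]
  exact frullani_exp_kernel_le y hz

/-- Frullani's integral for the exponential, as an integral representation of `log (1 + x / y)`. -/
lemma integral_frullani_exp_kernel {x y : ℝ} (hx : 0 ≤ x) (hy : 0 < y) :
    ∫ z in Set.Ioi (0 : ℝ), (1 / z) * ((1 - exp (-z * x)) * exp (-z * y))
      = log (1 + x / y) := by
  have heq : (fun z : ℝ => (1 / z) * ((1 - exp (-z * x)) * exp (-z * y)))
      = fun z => z⁻¹ • (exp (-(y * z)) - exp (-((x + y) * z))) := by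
    funext z
    rw [smul_eq_mul, one_div, one_sub_mul, ← exp_add]
    ring_nf
  have hint := integrableOn_frullani_exp_kernel hx hy
  rw [heq] at hint ⊢
  have hcont : Continuous fun t : ℝ => exp (-t) := by fun_prop
  have h0 : Filter.Tendsto (fun t : ℝ => exp (-t)) (nhdsWithin 0 (Set.Ioi 0)) (nhds 1) := by
    simpa using (hcont.tendsto 0).mono_left nhdsWithin_le_nhds
  rw [Frullani.integral_Ioi_eq (f := fun t : ℝ => exp (-t))
    (hcont.locallyIntegrable.locallyIntegrableOn _) hy (by positivity) h0
    tendsto_exp_neg_atTop_nhds_zero hint, sub_zero, smul_eq_mul, mul_one]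
  congr 1
  field_simp
  ring

lemma integrable_exp_neg_mul_of_nonneg {Ω : Type*} [MeasurableSpace Ω] {μ : Measure Ω}
    [IsFiniteMeasure μ] {X : Ω → ℝ} (hX : Measurable X) (hXpos : ∀ ω, 0 ≤ X ω) {z : ℝ}
    (hz : 0 < z) : Integrable (fun ω => exp (-z * X ω)) μ := by
  refine Integrable.of_bound (by fun_prop) 1 (.of_forall fun ω => ?_)
  rw [norm_of_nonneg (exp_pos _).le]
  exact exp_le_one_iff.2 (by nlinarith [hXpos ω])

/-- Hamdi's identity (equation (51)): for independent nonnegative random variables `X` and `Y`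
with `Y > 0` almost surely and `E[ln(1 + X/Y)]` finite,
`E[ln(1 + X/Y)] = ∫_0^∞ (1/z)(1 − E[e^{−zX}]) E[e^{−zY}] dz`. -/
theorem hamdi_identity {Ω : Type*} [MeasureSpace Ω]
    [IsProbabilityMeasure (ℙ : Measure Ω)] (X Y : Ω → ℝ)
    (hX : Measurable X) (hY : Measurable Y)
    (hXpos : ∀ ω, 0 ≤ X ω) (hYpos : ∀ᵐ ω ∂ℙ, 0 < Y ω)
    (hind : IndepFun X Y ℙ)
    (hint : Integrable (fun ω => Real.log (1 + X ω / Y ω)) ℙ) :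
    ∫ ω, Real.log (1 + X ω / Y ω) ∂ℙ
      = ∫ z in Set.Ioi (0 : ℝ),
          (1 / z) * (1 - ∫ ω, Real.exp (-z * X ω) ∂ℙ) * (∫ ω, Real.exp (-z * Y ω) ∂ℙ) := by
  have hkernel : ∀ᵐ ω ∂ℙ, ∫ z in Set.Ioi (0 : ℝ),
      (1 / z) * ((1 - exp (-z * X ω)) * exp (-z * Y ω)) = log (1 + X ω / Y ω) := by
    filter_upwards [hYpos] with ω hω
    exact integral_frullani_exp_kernel (hXpos ω) hω
  have hprod : Integrable
      (Function.uncurry fun ω z => (1 / z) * ((1 - exp (-z * X ω)) * exp (-z * Y ω)))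
      ((ℙ : Measure Ω).prod (volume.restrict (Set.Ioi (0 : ℝ)))) := by
    rw [integrable_prod_iff (Measurable.aestronglyMeasurable (by fun_prop))]
    refine ⟨?_, hint.congr ?_⟩
    · filter_upwards [hYpos] with ω hω
      exact integrableOn_frullani_exp_kernel (hXpos ω) hω
    · filter_upwards [hkernel] with ω hω
      rw [← hω]
      refine setIntegral_congr_fun measurableSet_Ioi fun z hz => ?_
      exact (norm_of_nonneg (frullani_exp_kernel_nonneg (Y ω) (hXpos ω) hz)).symm
  rw [← integral_congr_ae hkernel, integral_integral_swap hprod]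
  refine setIntegral_congr_fun measurableSet_Ioi fun z hz => ?_
  have hindz : IndepFun (fun ω => 1 - exp (-z * X ω)) (fun ω => exp (-z * Y ω)) ℙ :=
    hind.comp (φ := fun x => 1 - exp (-z * x)) (ψ := fun y => exp (-z * y))
      (by fun_prop) (by fun_prop)
  have hexp : ∫ ω, (1 - exp (-z * X ω)) ∂ℙ = 1 - ∫ ω, exp (-z * X ω) ∂ℙ := by
    rw [integral_sub (integrable_const 1) (integrable_exp_neg_mul_of_nonneg hX hXpos hz)]
    simp
  rw [integral_const_mul, hindz.integral_fun_mul_eq_mul_integral (by fun_prop) (by fun_prop),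
    hexp, mul_assoc]
end
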